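/- arXiv:1507.07089 — 2 statements merged into one kernel-verified Lean document; each statement's English description precedes it below -/
import Mathlib

section
/- Let x_1, …, x_m ∈ Fin k → ℝ be vectors with nonnegative entries, and let P, Q ∈ Δ_m with Q_j > 0 for every j. Let b_P ∈ Δ_k maximize b ↦ W(b, P) over Δ_k and let b_Q ∈ Δ_k maximize b ↦ W(b, Q) over Δ_k, and assume ⟨x_j, b_P⟩ > 0 and ⟨x_j, b_Q⟩ > 0 for every j with P_j > 0 or Q_j > 0. Then W(b_P, P) − W(b_Q, P) ≤ D(P‖Q). -/
/-- The probability simplex on `Fin n`. -/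
def simplex (n : ℕ) : Set (Fin n → ℝ) :=
  {p | (∀ i, 0 ≤ p i) ∧ ∑ i, p i = 1}

/-- The doubling rate of a portfolio `b` when the price-relative vector equals
`x j` with probability `P j`: `W(b,P) = ∑ j, P j * log ⟨x j, b⟩`. -/
noncomputable def doublingRate {m k : ℕ} (x : Fin m → Fin k → ℝ)
    (b : Fin k → ℝ) (P : Fin m → ℝ) : ℝ :=
  ∑ j, P j * Real.log (∑ i, x j i * b i)

/-- Information divergence (KL divergence) on the finite alphabet `Fin m`. -/
noncomputable def KL {m : ℕ} (P Q : Fin m → ℝ) : ℝ :=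
  ∑ j, P j * Real.log (P j / Q j)

/-- First-order optimality condition: if moving from `v` towards `u` does not increase the
`Q`-weighted sum of logarithms, then the weighted sum of the ratios `u j / v j` is at most the total
weight. -/
theorem sum_mul_div_le_sum_of_log_segment_le {ι : Type*} [Fintype ι] {Q u v : ι → ℝ}
    (hQ : ∀ j, 0 ≤ Q j) (hu : ∀ j, 0 < u j) (hv : ∀ j, 0 < v j)
    (hopt : ∀ t : ℝ, 0 < t → t < 1 →
      ∑ j, Q j * Real.log ((1 - t) * v j + t * u j) ≤ ∑ j, Q j * Real.log (v j)) :
    ∑ j, Q j * (u j / v j) ≤ ∑ j, Q j := by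
  have hle : ∀ t : ℝ, 0 < t → t < 1 →
      ∑ j, Q j * ((u j - v j) / ((1 - t) * v j + t * u j)) ≤ 0 := by
    intro t ht0 ht1
    have hterm : ∀ j, t * (Q j * ((u j - v j) / ((1 - t) * v j + t * u j))) ≤
        Q j * Real.log ((1 - t) * v j + t * u j) - Q j * Real.log (v j) := by
      intro j
      have hw : 0 < (1 - t) * v j + t * u j :=
        add_pos (mul_pos (sub_pos.2 ht1) (hv j)) (mul_pos ht0 (hu j))
      have hlog := Real.one_sub_inv_le_log_of_pos (div_pos hw (hv j))
      rw [Real.log_div hw.ne' (hv j).ne', inv_div] at hlog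
      have heq : 1 - v j / ((1 - t) * v j + t * u j) =
          t * ((u j - v j) / ((1 - t) * v j + t * u j)) := by
        rw [one_sub_div hw.ne', ← mul_div_assoc]
        congr 1
        ring
      rw [heq] at hlog
      linarith [mul_le_mul_of_nonneg_left hlog (hQ j)]
    have hsum := Finset.sum_le_sum fun j (_ : j ∈ Finset.univ) => hterm j
    rw [← Finset.mul_sum, Finset.sum_sub_distrib] at hsum
    by_contra! hc
    linarith [mul_pos ht0 hc, hopt t ht0 ht1]
  have hcont : ContinuousAt
      (fun t : ℝ => ∑ j, Q j * ((u j - v j) / ((1 - t) * v j + t * u j))) 0 := by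
    refine tendsto_finsetSum _ fun j _ => ?_
    have hne : (1 - (0 : ℝ)) * v j + 0 * u j ≠ 0 := by simpa using (hv j).ne'
    have : ContinuousAt
        (fun t : ℝ => Q j * ((u j - v j) / ((1 - t) * v j + t * u j))) 0 := by
      fun_prop (disch := exact hne)
    exact this
  have hlim := le_of_tendsto (hcont.tendsto.mono_left (nhdsWithin_le_nhds (s := Set.Ioi 0)))
    (Filter.mem_of_superset (Ioo_mem_nhdsGT zero_lt_one) fun t ht => hle t ht.1 ht.2)
  have heq : ∀ j, Q j * ((u j - v j) / ((1 - 0) * v j + 0 * u j)) = Q j * (u j / v j) - Q j := by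
    intro j
    have := (hv j).ne'
    rw [sub_zero, one_mul, zero_mul, add_zero, sub_div, div_self this, mul_sub, mul_one]
  simp only [heq, Finset.sum_sub_distrib] at hlim
  linarith

theorem mul_log_div_sub_mul_log_div_le {p q u v : ℝ} (hp : 0 ≤ p) (hq : 0 < q)
    (hu : 0 < u) (hv : 0 < v) :
    p * Real.log u - p * Real.log v - p * Real.log (p / q) ≤ q * (u / v) - p := by
  rcases hp.eq_or_lt with rfl | hp
  · simp only [zero_mul, sub_zero]
    positivity
  · have hlog := Real.log_le_sub_one_of_pos (show 0 < q * (u / v) / p by positivity)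
    rw [Real.log_div (by positivity) hp.ne', Real.log_mul hq.ne' (by positivity),
      Real.log_div hu.ne' hv.ne'] at hlog
    rw [Real.log_div hp.ne' hq.ne']
    have hmul := mul_le_mul_of_nonneg_left hlog hp.le
    rw [mul_sub p _ 1, mul_div_cancel₀ _ hp.ne'] at hmul
    linarith

theorem convex_simplex (n : ℕ) : Convex ℝ (simplex n) :=
  convex_stdSimplex ℝ (Fin n)

theorem doubling_rate_regret_le_KL {m k : ℕ} (x : Fin m → Fin k → ℝ)
    (hx : ∀ j i, 0 ≤ x j i)
    (P : Fin m → ℝ) (hP : P ∈ simplex m)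
    (Q : Fin m → ℝ) (hQ : Q ∈ simplex m) (hQpos : ∀ j, 0 < Q j)
    (bP : Fin k → ℝ) (hbP : bP ∈ simplex k)
    (hbPopt : ∀ b ∈ simplex k, doublingRate x b P ≤ doublingRate x bP P)
    (bQ : Fin k → ℝ) (hbQ : bQ ∈ simplex k)
    (hbQopt : ∀ b ∈ simplex k, doublingRate x b Q ≤ doublingRate x bQ Q)
    (hpos : ∀ j, (0 < P j ∨ 0 < Q j) →
      0 < ∑ i, x j i * bP i ∧ 0 < ∑ i, x j i * bQ i) :
    doublingRate x bP P - doublingRate x bQ P ≤ KL P Q := by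
  have hu : ∀ j, 0 < ∑ i, x j i * bP i := fun j => (hpos j (Or.inr (hQpos j))).1
  have hv : ∀ j, 0 < ∑ i, x j i * bQ i := fun j => (hpos j (Or.inr (hQpos j))).2
  have hratio := sum_mul_div_le_sum_of_log_segment_le (fun j => (hQpos j).le) hu hv <| by
    intro t ht0 ht1
    have hopt := hbQopt _ (convex_simplex k hbQ hbP (sub_nonneg.2 ht1.le) ht0.le
      (sub_add_cancel 1 t))
    have hlin : ∀ j, ∑ i, x j i * ((1 - t) • bQ + t • bP) i =
        (1 - t) * ∑ i, x j i * bQ i + t * ∑ i, x j i * bP i := by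
      intro j
      rw [Finset.mul_sum, Finset.mul_sum, ← Finset.sum_add_distrib]
      refine Finset.sum_congr rfl fun i _ => ?_
      simp only [Pi.add_apply, Pi.smul_apply, smul_eq_mul]
      ring
    simpa only [doublingRate, hlin] using hopt
  have hsum := Finset.sum_le_sum fun j (_ : j ∈ Finset.univ) =>
    mul_log_div_sub_mul_log_div_le (hP.1 j) (hQpos j) (hu j) (hv j)
  simp only [Finset.sum_sub_distrib] at hsum
  rw [hP.2] at hsum
  rw [hQ.2] at hratio
  unfold doublingRate KL
  linarith
end

section
/- Let x_1, …, x_m ∈ Fin k → ℝ have nonnegative entries, let P, Q ∈ Δ_m have strictly positive entries, let b_P maximize W(·, P) and b_Q maximize W(·, Q) over Δ_k, and assume ⟨x_j, b_P⟩ > 0 and ⟨x_j, b_Q⟩ > 0 for all j. If W(b_P, P) − W(b_Q, P) = D(P‖Q), then the ratio (⟨x_j, b_P⟩ / ⟨x_j, b_Q⟩) · (Q_j / P_j) is constant in j: there exists c ∈ ℝ such that ⟨x_j, b_P⟩ / ⟨x_j, b_Q⟩ = c · P_j / Q_j for every j. -/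
open Filter Topology in
/-- First-order optimality at `1` along the segments `1 - t + t * u j` bounds the weighted mean. -/
lemma sum_mul_sub_one_nonpos_of_sum_mul_log_nonpos {ι : Type*} [Fintype ι] {q u : ι → ℝ}
    (hq : ∀ j, 0 ≤ q j) (hu : ∀ j, 0 < u j)
    (h : ∀ t : ℝ, 0 < t → t ≤ 1 → ∑ j, q j * Real.log (1 + t * (u j - 1)) ≤ 0) :
    ∑ j, q j * (u j - 1) ≤ 0 := by
  have hcont : ContinuousAt (fun t : ℝ => ∑ j, q j * ((u j - 1) / (1 + t * (u j - 1)))) 0 := by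
    refine tendsto_finsetSum _ fun j _ => ?_
    have : ContinuousAt (fun t : ℝ => q j * ((u j - 1) / (1 + t * (u j - 1)))) 0 :=
      continuousAt_const.mul (continuousAt_const.div (by fun_prop) (by simp))
    exact this
  have hlim := hcont.tendsto.mono_left (nhdsWithin_le_nhds (s := Set.Ioi 0))
  simp only [zero_mul, add_zero, div_one] at hlim
  refine le_of_tendsto hlim ?_
  filter_upwards [Ioc_mem_nhdsGT (zero_lt_one' ℝ)] with t ⟨ht0, ht1⟩
  have hle : t * ∑ j, q j * ((u j - 1) / (1 + t * (u j - 1))) ≤ 0 := by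
    refine le_trans ?_ (h t ht0 ht1)
    rw [Finset.mul_sum]
    refine Finset.sum_le_sum fun j _ => ?_
    have hpos : 0 < 1 + t * (u j - 1) := by nlinarith [mul_pos ht0 (hu j)]
    have hlog := mul_le_mul_of_nonneg_left (Real.one_sub_inv_le_log_of_pos hpos) (hq j)
    convert hlog using 1
    field_simp
    ring
  exact nonpos_of_mul_nonpos_right hle ht0

/-- Equality case of Jensen's inequality for the logarithm at mean at most `1`. -/
lemma eq_one_of_sum_mul_log_eq_zero {ι : Type*} [Fintype ι] {p s : ι → ℝ}
    (hp : ∀ j, 0 < p j) (hs : ∀ j, 0 < s j) (hmean : ∑ j, p j * (s j - 1) ≤ 0)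
    (hlog : ∑ j, p j * Real.log (s j) = 0) (j : ι) : s j = 1 := by
  have hle : ∀ j ∈ Finset.univ, p j * Real.log (s j) ≤ p j * (s j - 1) := fun j _ =>
    mul_le_mul_of_nonneg_left (Real.log_le_sub_one_of_pos (hs j)) (hp j).le
  have hsum := le_antisymm (Finset.sum_le_sum hle) (hmean.trans hlog.ge)
  have hj := (Finset.sum_eq_sum_iff_of_le hle).1 hsum j (Finset.mem_univ j)
  by_contra hne
  exact (Real.log_lt_sub_one_of_pos (hs j) hne).ne (mul_left_cancel₀ (hp j).ne' hj)

/-- The Kuhn–Tucker inequality for a log-optimal portfolio. -/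
lemma sum_mul_div_sub_one_nonpos {m k : ℕ} {x : Fin m → Fin k → ℝ} {Q : Fin m → ℝ}
    (hQ : ∀ j, 0 ≤ Q j) {b bQ : Fin k → ℝ} (hb : b ∈ simplex k) (hbQ : bQ ∈ simplex k)
    (hopt : ∀ b ∈ simplex k, doublingRate x b Q ≤ doublingRate x bQ Q)
    (hpos : ∀ j, 0 < ∑ i, x j i * b i) (hposQ : ∀ j, 0 < ∑ i, x j i * bQ i) :
    ∑ j, Q j * ((∑ i, x j i * b i) / (∑ i, x j i * bQ i) - 1) ≤ 0 := by
  refine sum_mul_sub_one_nonpos_of_sum_mul_log_nonpos hQ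
    (fun j => div_pos (hpos j) (hposQ j)) fun t ht0 ht1 => ?_
  have hmem : (fun i => (1 - t) * bQ i + t * b i) ∈ simplex k := by
    refine ⟨fun i => add_nonneg (mul_nonneg (by linarith) (hbQ.1 i))
      (mul_nonneg ht0.le (hb.1 i)), ?_⟩
    rw [Finset.sum_add_distrib, ← Finset.mul_sum, ← Finset.mul_sum, hbQ.2, hb.2]
    ring
  have h := sub_nonpos.2 (hopt _ hmem)
  rw [doublingRate, doublingRate, ← Finset.sum_sub_distrib] at h
  refine (Finset.sum_congr rfl fun j _ => ?_).trans_le h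
  have hsum : ∑ i, x j i * ((1 - t) * bQ i + t * b i)
      = (1 - t) * ∑ i, x j i * bQ i + t * ∑ i, x j i * b i := by
    rw [Finset.mul_sum, Finset.mul_sum, ← Finset.sum_add_distrib]
    exact Finset.sum_congr rfl fun i _ => by ring
  have hA := hpos j
  have hB := hposQ j
  rw [hsum, ← mul_sub, ← Real.log_div _ hB.ne']
  · congr 2
    field_simp
    ring
  · have := mul_nonneg (sub_nonneg.2 ht1) hB.le
    have := mul_pos ht0 hA
    linarith

theorem KL_equality_implies_proportional_ratio {m k : ℕ} (x : Fin m → Fin k → ℝ)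
    (hx : ∀ j i, 0 ≤ x j i)
    (P : Fin m → ℝ) (hP : P ∈ simplex m) (hPpos : ∀ j, 0 < P j)
    (Q : Fin m → ℝ) (hQ : Q ∈ simplex m) (hQpos : ∀ j, 0 < Q j)
    (bP : Fin k → ℝ) (hbP : bP ∈ simplex k)
    (hbPopt : ∀ b ∈ simplex k, doublingRate x b P ≤ doublingRate x bP P)
    (bQ : Fin k → ℝ) (hbQ : bQ ∈ simplex k)
    (hbQopt : ∀ b ∈ simplex k, doublingRate x b Q ≤ doublingRate x bQ Q)
    (hposP : ∀ j, 0 < ∑ i, x j i * bP i) (hposQ : ∀ j, 0 < ∑ i, x j i * bQ i)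
    (heq : doublingRate x bP P - doublingRate x bQ P = KL P Q) :
    ∃ c : ℝ, ∀ j, (∑ i, x j i * bP i) / (∑ i, x j i * bQ i) = c * (P j / Q j) := by
  have hkt := sum_mul_div_sub_one_nonpos (fun j => (hQpos j).le) hbP hbQ hbQopt hposP hposQ
  refine ⟨1, fun j => ?_⟩
  have hone := eq_one_of_sum_mul_log_eq_zero (p := P)
    (s := fun j => ((∑ i, x j i * bP i) / ∑ i, x j i * bQ i) / (P j / Q j)) hPpos
    (fun j => div_pos (div_pos (hposP j) (hposQ j)) (div_pos (hPpos j) (hQpos j))) ?_ ?_ j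
  · rw [one_mul]
    exact (div_eq_one_iff_eq (div_pos (hPpos j) (hQpos j)).ne').1 hone
  · refine le_trans (le_of_eq ?_) hkt
    simp only [mul_sub, Finset.sum_sub_distrib, mul_one, hP.2, hQ.2]
    congr 1
    refine Finset.sum_congr rfl fun j _ => ?_
    have := (hPpos j).ne'
    have := (hQpos j).ne'
    field_simp
  · rw [← sub_eq_zero, doublingRate, doublingRate, KL, ← Finset.sum_sub_distrib,
      ← Finset.sum_sub_distrib] at heq
    rw [← heq]
    refine Finset.sum_congr rfl fun j _ => ?_
    rw [Real.log_div (div_pos (hposP j) (hposQ j)).ne' (div_pos (hPpos j) (hQpos j)).ne',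
      Real.log_div (hposP j).ne' (hposQ j).ne']
    ring
end
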